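/- For every A ∈ N_B and every m ∈ ℕ, rank((A^{s_B})^m) ≤ rank(J^m). -/

import Mathlib

open Matrix

/-- The Jordan matrix of the partition `μ`. -/
def jordanMatrix (K : Type*) [Field K] (t : ℕ) (μ : Fin t → ℕ) :
    Matrix (Σ i : Fin t, Fin (μ i)) (Σ i : Fin t, Fin (μ i)) K :=
  fun p q => if p.1 = q.1 ∧ (p.2 : ℕ) + 1 = (q.2 : ℕ) then 1 else 0

section JordanEntries

variable {K : Type*} [Field K] {t : ℕ} {μ : Fin t → ℕ}

lemma mul_jordanMatrix_apply_zero (A : Matrix (Σ i : Fin t, Fin (μ i)) (Σ i : Fin t, Fin (μ i)) K)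
    (p : Σ i : Fin t, Fin (μ i)) (j : Fin t) (h : 0 < μ j) :
    (A * jordanMatrix K t μ) p ⟨j, ⟨0, h⟩⟩ = 0 := by
  simp [Matrix.mul_apply, jordanMatrix]

lemma mul_jordanMatrix_apply_succ (A : Matrix (Σ i : Fin t, Fin (μ i)) (Σ i : Fin t, Fin (μ i)) K)
    (p : Σ i : Fin t, Fin (μ i)) (j : Fin t) (b : ℕ) (h : b + 1 < μ j) :
    (A * jordanMatrix K t μ) p ⟨j, ⟨b + 1, h⟩⟩ = A p ⟨j, ⟨b, by omega⟩⟩ := by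
  rw [Matrix.mul_apply, Finset.sum_eq_single ⟨j, ⟨b, by omega⟩⟩]
  · simp [jordanMatrix]
  · rintro ⟨i, a, ha⟩ - hne
    have : ¬ (i = j ∧ a + 1 = b + 1) := by
      rintro ⟨rfl, h2⟩
      obtain rfl : a = b := by omega
      exact hne rfl
    simp only [jordanMatrix, if_neg this, mul_zero]
  · simp

lemma jordanMatrix_mul_apply_last (A : Matrix (Σ i : Fin t, Fin (μ i)) (Σ i : Fin t, Fin (μ i)) K)
    (q : Σ i : Fin t, Fin (μ i)) (i : Fin t) (a : ℕ) (h : a < μ i) (hlast : a + 1 = μ i) :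
    (jordanMatrix K t μ * A) ⟨i, ⟨a, h⟩⟩ q = 0 := by
  rw [Matrix.mul_apply]
  refine Finset.sum_eq_zero ?_
  rintro ⟨j, b, hb⟩ -
  have : ¬ (i = j ∧ a + 1 = b) := by
    rintro ⟨rfl, h2⟩
    omega
  simp only [jordanMatrix, if_neg this, zero_mul]

lemma jordanMatrix_mul_apply_succ (A : Matrix (Σ i : Fin t, Fin (μ i)) (Σ i : Fin t, Fin (μ i)) K)
    (q : Σ i : Fin t, Fin (μ i)) (i : Fin t) (a : ℕ) (h : a + 1 < μ i) :
    (jordanMatrix K t μ * A) ⟨i, ⟨a, by omega⟩⟩ q = A ⟨i, ⟨a + 1, h⟩⟩ q := by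
  rw [Matrix.mul_apply, Finset.sum_eq_single ⟨i, ⟨a + 1, h⟩⟩]
  · simp [jordanMatrix]
  · rintro ⟨j, b, hb⟩ - hne
    have : ¬ (i = j ∧ a + 1 = b) := by
      rintro ⟨rfl, rfl⟩
      exact hne rfl
    simp only [jordanMatrix, if_neg this, zero_mul]
  · simp

lemma jordanMatrix_pow_apply (m : ℕ) (p q : Σ i : Fin t, Fin (μ i)) :
    (jordanMatrix K t μ ^ m) p q = if p.1 = q.1 ∧ (p.2 : ℕ) + m = (q.2 : ℕ) then 1 else 0 := by
  induction m generalizing p with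
  | zero =>
    obtain ⟨i, a, ha⟩ := p
    obtain ⟨j, b, hb⟩ := q
    rw [pow_zero, Matrix.one_apply]
    refine if_congr ?_ rfl rfl
    constructor
    · rintro h
      cases h
      simp
    · rintro ⟨h1, h2⟩
      dsimp only at h1 h2
      subst h1
      obtain rfl : a = b := h2
      rfl
  | succ m ih =>
    obtain ⟨i, a, ha⟩ := p
    rw [pow_succ']
    by_cases h : a + 1 < μ i
    · rw [jordanMatrix_mul_apply_succ _ _ _ _ h, ih]
      refine if_congr ?_ rfl rfl
      dsimp only
      rw [add_assoc, add_comm 1 m]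
    · rw [jordanMatrix_mul_apply_last _ _ _ _ _ (by omega), if_neg]
      rintro ⟨h1, h2⟩
      obtain ⟨j, b, hb⟩ := q
      dsimp only at h1 h2
      subst h1
      omega

/-- The rank of `J ^ m` is at least the number of boxes with at least `m` boxes to their right. -/
lemma card_le_rank_jordanMatrix_pow (m : ℕ) :
    (Finset.univ.filter fun p : Σ i : Fin t, Fin (μ i) => (p.2 : ℕ) + m < μ p.1).card ≤
      (jordanMatrix K t μ ^ m).rank := by
  classical
  have key : jordanMatrix K t μ ^ m * (jordanMatrix K t μ ^ m)ᵀ =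
      diagonal fun p => if (p.2 : ℕ) + m < μ p.1 then (1 : K) else 0 := by
    ext ⟨i, a, ha⟩ ⟨j, b, hb⟩
    simp only [Matrix.mul_apply, Matrix.transpose_apply, jordanMatrix_pow_apply,
      Matrix.diagonal_apply]
    by_cases h : a + m < μ i
    · rw [Finset.sum_eq_single ⟨i, ⟨a + m, h⟩⟩]
      · by_cases hij : j = i ∧ b = a
        · obtain ⟨rfl, rfl⟩ := hij
          simp [h]
        · rw [if_neg (c := (⟨i, ⟨a, ha⟩⟩ : Σ i : Fin t, Fin (μ i)) = ⟨j, ⟨b, hb⟩⟩)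
            (by rintro h; cases h; exact hij ⟨rfl, rfl⟩)]
          simp only [add_left_inj, hij, if_false, mul_zero]
      · rintro ⟨k, c, hc⟩ - hne
        rw [if_neg (c := i = k ∧ a + m = c), zero_mul]
        rintro ⟨rfl, rfl⟩
        exact hne rfl
      · simp
    · rw [if_neg h, ite_self]
      refine Finset.sum_eq_zero ?_
      rintro ⟨k, c, hc⟩ -
      rw [if_neg (c := i = k ∧ a + m = c), zero_mul]
      rintro ⟨rfl, rfl⟩
      exact h hc
  have hr := Matrix.rank_mul_le_left (jordanMatrix K t μ ^ m) (jordanMatrix K t μ ^ m)ᵀ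
  rw [key, Matrix.rank_diagonal, Fintype.card_subtype] at hr
  simpa using hr

/-- The weight of a box for the grading by `sl₂`-weights, which is symmetric about `0` in each row. -/
def boxWeight (p : Σ i : Fin t, Fin (μ i)) : ℤ := 2 * (p.2 : ℕ) + 1 - μ p.1

/-- The relation on boxes supporting every matrix that commutes with the Jordan matrix. -/
def BoxLE (p q : Σ i : Fin t, Fin (μ i)) : Prop :=
  |(μ p.1 : ℤ) - μ q.1| ≤ boxWeight q - boxWeight p

lemma BoxLE.refl (p : Σ i : Fin t, Fin (μ i)) : BoxLE p p := by
  simp [BoxLE]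

lemma BoxLE.trans {p q r : Σ i : Fin t, Fin (μ i)} (h : BoxLE p q) (h' : BoxLE q r) :
    BoxLE p r := by
  simp only [BoxLE, abs_le] at *
  omega

lemma apply_eq_zero_of_lt {A : Matrix (Σ i : Fin t, Fin (μ i)) (Σ i : Fin t, Fin (μ i)) K}
    (hA : A * jordanMatrix K t μ = jordanMatrix K t μ * A) (i j : Fin t) (a b : ℕ)
    (ha : a < μ i) (hb : b < μ j) (hba : b < a) : A ⟨i, ⟨a, ha⟩⟩ ⟨j, ⟨b, hb⟩⟩ = 0 := by
  induction b generalizing a with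
  | zero =>
    obtain ⟨a, rfl⟩ := Nat.exists_eq_add_one.mpr hba
    rw [← jordanMatrix_mul_apply_succ A _ _ _ ha, ← hA, mul_jordanMatrix_apply_zero]
  | succ b ih =>
    obtain ⟨a, rfl⟩ : ∃ c, a = c + 1 := ⟨a - 1, by omega⟩
    rw [← jordanMatrix_mul_apply_succ A _ _ _ ha, ← hA, mul_jordanMatrix_apply_succ _ _ _ _ hb]
    exact ih _ _ _ (by omega)

lemma apply_eq_zero_of_sub_lt_sub
    {A : Matrix (Σ i : Fin t, Fin (μ i)) (Σ i : Fin t, Fin (μ i)) K}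
    (hA : A * jordanMatrix K t μ = jordanMatrix K t μ * A) (i j : Fin t) (a b : ℕ)
    (ha : a < μ i) (hb : b < μ j) (hba : μ i - a < μ j - b) :
    A ⟨i, ⟨a, ha⟩⟩ ⟨j, ⟨b, hb⟩⟩ = 0 := by
  induction hk : μ i - a generalizing a b with
  | zero => omega
  | succ k ih =>
    rw [← mul_jordanMatrix_apply_succ A _ _ _ (by omega), hA]
    by_cases h : a + 1 < μ i
    · rw [jordanMatrix_mul_apply_succ _ _ _ _ h]
      exact ih _ _ _ _ (by omega) (by omega)
    · exact jordanMatrix_mul_apply_last _ _ _ _ _ (by omega)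

lemma boxLE_of_apply_ne_zero {A : Matrix (Σ i : Fin t, Fin (μ i)) (Σ i : Fin t, Fin (μ i)) K}
    (hA : A * jordanMatrix K t μ = jordanMatrix K t μ * A) {p q : Σ i : Fin t, Fin (μ i)}
    (h : A p q ≠ 0) : BoxLE p q := by
  obtain ⟨i, a, ha⟩ := p
  obtain ⟨j, b, hb⟩ := q
  have h1 : ¬ b < a := fun h' => h (apply_eq_zero_of_lt hA _ _ _ _ _ _ h')
  have h2 : ¬ μ i - a < μ j - b := fun h' => h (apply_eq_zero_of_sub_lt_sub hA _ _ _ _ _ _ h')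
  simp only [BoxLE, boxWeight, abs_le]
  omega

end JordanEntries

/-- Restricting matrices supported on a transitive relation to an interval is multiplicative. -/
lemma submatrix_pow_of_support {ι K : Type*} [Fintype ι] [DecidableEq ι] [Field K]
    {R : ι → ι → Prop} (htrans : ∀ {a b c}, R a b → R b c → R a c)
    {A : Matrix ι ι K} (hA : ∀ k a b, (A ^ k) a b ≠ 0 → R a b)
    (p q : ι) [Fintype {r // R p r ∧ R r q}] (k : ℕ) :
    (A.submatrix (Subtype.val : {r // R p r ∧ R r q} → ι)
      (Subtype.val : {r // R p r ∧ R r q} → ι)) ^ k =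
      (A ^ k).submatrix Subtype.val Subtype.val := by
  classical
  induction k with
  | zero =>
    rw [pow_zero, pow_zero, Matrix.submatrix_one _ Subtype.val_injective]
  | succ k ih =>
    rw [pow_succ, pow_succ, ih]
    ext a b
    simp only [Matrix.mul_apply, Matrix.submatrix_apply]
    refine Finset.sum_of_injOn Subtype.val Subtype.val_injective.injOn (by simp) ?_ (by simp)
    rintro r - hr
    by_contra hne
    have h1 := hA k a r (left_ne_zero_of_mul hne)
    have h2 := hA 1 r b (by simpa using right_ne_zero_of_mul hne)
    exact hr ⟨⟨r, htrans a.2.1 h1, htrans h2 b.2.2⟩, by simp, rfl⟩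

/-- A nilpotent matrix of size at most `s` has vanishing `s`-th power. -/
lemma pow_eq_zero_of_isNilpotent_of_card_le {ι K : Type*} [Fintype ι] [DecidableEq ι] [Field K]
    {A : Matrix ι ι K} (hA : IsNilpotent A) {s : ℕ} (hs : Fintype.card ι ≤ s) : A ^ s = 0 := by
  refine pow_eq_zero_of_le hs ?_
  have h := Matrix.aeval_self_charpoly A
  rwa [sub_eq_zero.mp (Matrix.isNilpotent_charpoly_sub_pow_of_isNilpotent hA).eq_zero, map_pow,
    Polynomial.aeval_X] at h

/-- If a nilpotent matrix `A` and its powers are supported on a preorder, then `A ^ s` vanishes at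
`(p, q)` as soon as the interval from `p` to `q` has at most `s` elements. -/
lemma pow_apply_eq_zero_of_card_interval_le {ι K : Type*} [Fintype ι] [DecidableEq ι] [Field K]
    {R : ι → ι → Prop} (hrefl : ∀ a, R a a) (htrans : ∀ {a b c}, R a b → R b c → R a c)
    {A : Matrix ι ι K} (hA : ∀ k a b, (A ^ k) a b ≠ 0 → R a b) (hnil : IsNilpotent A)
    {p q : ι} {s : ℕ} (hcard : ∀ S : Finset ι, (∀ r ∈ S, R p r ∧ R r q) → S.card ≤ s) :
    (A ^ s) p q = 0 := by
  classical
  by_contra h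
  have hpow := submatrix_pow_of_support (R := R) htrans hA p q
  have hnil' : IsNilpotent (A.submatrix (Subtype.val : {r // R p r ∧ R r q} → ι)
      (Subtype.val : {r // R p r ∧ R r q} → ι)) := by
    obtain ⟨k, hk⟩ := hnil
    refine ⟨k, ?_⟩
    rw [hpow, hk, Matrix.submatrix_zero]
    rfl
  have hle : Fintype.card {r // R p r ∧ R r q} ≤ s := by
    rw [Fintype.card_subtype]
    exact hcard _ fun r hr => (Finset.mem_filter.mp hr).2
  have hzero := pow_eq_zero_of_isNilpotent_of_card_le hnil' hle
  have hpq := hA s p q h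
  rw [hpow] at hzero
  exact h (congrFun (congrFun hzero ⟨p, hrefl p, hpq⟩) ⟨q, hpq, hrefl q⟩)

lemma rank_add_le {ι K : Type*} [Fintype ι] [Field K] (A B : Matrix ι ι K) :
    (A + B).rank ≤ A.rank + B.rank := by
  rw [Matrix.rank, Matrix.rank, Matrix.rank, Matrix.mulVecLin_add]
  exact (Submodule.finrank_mono (LinearMap.range_add_le _ _)).trans
    (Submodule.finrank_add_le_finrank_add_finrank _ _)

/-- A matrix vanishing outside given rows and columns has rank at most their total number. -/
lemma rank_le_card_add_card {ι K : Type*} [Fintype ι] [DecidableEq ι] [Field K]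
    (N : Matrix ι ι K) (P Q : ι → Prop) [DecidablePred P] [DecidablePred Q]
    (h : ∀ p q, N p q ≠ 0 → P p ∨ Q q) :
    N.rank ≤ (Finset.univ.filter P).card + (Finset.univ.filter Q).card := by
  let D (S : ι → Prop) [DecidablePred S] : Matrix ι ι K := diagonal fun i => if S i then 1 else 0
  have hD (S : ι → Prop) [DecidablePred S] : (D S).rank = (Finset.univ.filter S).card := by
    classical
    rw [Matrix.rank_diagonal, Fintype.card_subtype]
    simp
  have hN : N = D P * (N * (1 - D Q)) + N * D Q := by
    ext p q
    have := h p q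
    simp only [D, Matrix.add_apply, Matrix.diagonal_mul, Matrix.mul_sub, Matrix.mul_one,
      Matrix.sub_apply, Matrix.mul_diagonal]
    by_cases hP : P p <;> by_cases hQ : Q q <;> simp_all
  calc N.rank = (D P * (N * (1 - D Q)) + N * D Q).rank := by rw [← hN]
    _ ≤ (D P * (N * (1 - D Q))).rank + (N * D Q).rank := rank_add_le _ _
    _ ≤ (D P).rank + (D Q).rank :=
      add_le_add (Matrix.rank_mul_le_left _ _) (Matrix.rank_mul_le_right _ _)
    _ = _ := by rw [hD, hD]

section Weights

variable {K : Type*} [Field K] {t : ℕ} {μ : Fin t → ℕ}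

/-- An interval of boxes whose endpoints differ in weight by at most `1` has at most as many elements
as the largest almost rectangular subpartition. -/
lemma card_interval_le {s : ℕ}
    (hs : s ∈ upperBounds {d : ℕ | ∃ i j : Fin t, i ≤ j ∧ μ i ≤ μ j + 1 ∧
      d = (j : ℕ) - (i : ℕ) + 1})
    {p q : Σ i : Fin t, Fin (μ i)} (hw : boxWeight q < boxWeight p + 2)
    (S : Finset (Σ i : Fin t, Fin (μ i))) (hS : ∀ r ∈ S, BoxLE p r ∧ BoxLE r q) :
    S.card ≤ s := by
  classical
  rcases S.eq_empty_or_nonempty with rfl | hne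
  · simp
  simp only [BoxLE, abs_le] at hS
  have hinj : Set.InjOn (Sigma.fst : (Σ i : Fin t, Fin (μ i)) → Fin t) S := by
    rintro ⟨i, a, ha⟩ h1 ⟨j, b, hb⟩ h2 hij
    dsimp only at hij
    subst hij
    have h1 := hS _ h1
    have h2 := hS _ h2
    have h3 : boxWeight (⟨i, ⟨a, ha⟩⟩ : Σ i : Fin t, Fin (μ i)) = 2 * (a : ℕ) + 1 - μ i := rfl
    have h4 : boxWeight (⟨i, ⟨b, hb⟩⟩ : Σ i : Fin t, Fin (μ i)) = 2 * (b : ℕ) + 1 - μ i := rfl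
    obtain rfl : a = b := by omega
    rfl
  have hne' : (S.image Sigma.fst).Nonempty := hne.image _
  obtain ⟨x, hx, hx'⟩ := Finset.mem_image.mp (Finset.min'_mem _ hne')
  obtain ⟨y, hy, hy'⟩ := Finset.mem_image.mp (Finset.max'_mem _ hne')
  have hsub : S.image Sigma.fst ⊆ Finset.Icc x.1 y.1 := by
    intro i hi
    rw [Finset.mem_Icc, hx', hy']
    exact ⟨Finset.min'_le _ _ hi, Finset.le_max' _ _ hi⟩
  have hxy : x.1 ≤ y.1 := by
    rw [hx', hy']
    exact Finset.min'_le_max' _ hne'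
  have hcard := Finset.card_le_card hsub
  rw [Finset.card_image_of_injOn hinj, Fin.card_Icc] at hcard
  have hle : (y.1 : ℕ) - (x.1 : ℕ) + 1 ≤ s := by
    refine hs ⟨x.1, y.1, hxy, ?_, rfl⟩
    have h1 := hS x hx
    have h2 := hS y hy
    omega
  have : (x.1 : ℕ) ≤ y.1 := hxy
  omega

lemma two_le_boxWeight_sub_of_pow_apply_ne_zero {s : ℕ}
    (hs : s ∈ upperBounds {d : ℕ | ∃ i j : Fin t, i ≤ j ∧ μ i ≤ μ j + 1 ∧
      d = (j : ℕ) - (i : ℕ) + 1})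
    {A : Matrix (Σ i : Fin t, Fin (μ i)) (Σ i : Fin t, Fin (μ i)) K}
    (hA : A * jordanMatrix K t μ = jordanMatrix K t μ * A) (hnil : IsNilpotent A)
    {p q : Σ i : Fin t, Fin (μ i)} (h : (A ^ s) p q ≠ 0) :
    boxWeight p + 2 ≤ boxWeight q := by
  classical
  by_contra! hw
  have hsupp : ∀ k p q, (A ^ k) p q ≠ 0 → BoxLE p q := fun k p q =>
    boxLE_of_apply_ne_zero (Commute.pow_left (show Commute A _ from hA) k).eq
  exact h (pow_apply_eq_zero_of_card_interval_le (R := BoxLE) BoxLE.refl BoxLE.trans hsupp hnil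
    fun S hS => card_interval_le hs hw S hS)

lemma boxWeight_add_le_of_pow_apply_ne_zero
    {N : Matrix (Σ i : Fin t, Fin (μ i)) (Σ i : Fin t, Fin (μ i)) K}
    (hN : ∀ p q, N p q ≠ 0 → boxWeight p + 2 ≤ boxWeight q) (m : ℕ)
    {p q : Σ i : Fin t, Fin (μ i)} (h : (N ^ m) p q ≠ 0) :
    boxWeight p + 2 * m ≤ boxWeight q := by
  induction m generalizing q with
  | zero =>
    by_cases hpq : p = q
    · simp [hpq]
    · simp [hpq] at h
  | succ m ih =>
    rw [pow_succ, Matrix.mul_apply] at h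
    obtain ⟨r, -, hr⟩ := Finset.exists_ne_zero_of_sum_ne_zero h
    have h1 := ih (left_ne_zero_of_mul hr)
    have h2 := hN _ _ (right_ne_zero_of_mul hr)
    push_cast
    linarith

lemma card_boxWeight_lt_add_card_le_boxWeight (m : ℕ) :
    (Finset.univ.filter fun p : Σ i : Fin t, Fin (μ i) => boxWeight p < -m).card +
      (Finset.univ.filter fun p : Σ i : Fin t, Fin (μ i) => (m : ℤ) ≤ boxWeight p).card ≤
    (Finset.univ.filter fun p : Σ i : Fin t, Fin (μ i) => (p.2 : ℕ) + m < μ p.1).card := by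
  classical
  have hshift : ∀ p : Σ i : Fin t, Fin (μ i), ∃ c : Fin (μ p.1),
      ((m : ℤ) ≤ boxWeight p → (c : ℕ) = p.2 - m) ∧ (boxWeight p < m → (c : ℕ) = p.2) := by
    intro p
    by_cases h : (m : ℤ) ≤ boxWeight p
    · exact ⟨⟨p.2 - m, by omega⟩, fun _ => rfl, fun h' => by omega⟩
    · exact ⟨p.2, fun h' => absurd h' h, fun _ => rfl⟩
  choose f hf using hshift
  rw [← Finset.card_union_of_disjoint]
  · refine Finset.card_le_card_of_injOn (fun p => ⟨p.1, f p⟩) ?_ ?_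
    · rintro p h
      have h1 := hf p
      simp only [Finset.mem_coe, Finset.mem_union, Finset.mem_filter, Finset.mem_univ,
        true_and] at h ⊢
      simp only [boxWeight] at h h1
      omega
    · rintro ⟨i, a, ha⟩ h ⟨j, b, hb⟩ h' heq
      have h1 := hf ⟨i, a, ha⟩
      have h2 := hf ⟨j, b, hb⟩
      simp only [Finset.mem_coe, Finset.mem_union, Finset.mem_filter, Finset.mem_univ, true_and,
        Sigma.mk.injEq] at h h' heq
      simp only [boxWeight] at h h' h1 h2
      obtain ⟨rfl, heq⟩ := heq
      have heq := congrArg Fin.val (eq_of_heq heq)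
      obtain rfl : a = b := by omega
      rfl
  · rw [Finset.disjoint_filter]
    intro p _ h
    omega

end Weights

/-- If `s = s_B` is the maximum cardinality `j - i + 1` of an almost rectangular
subpartition `(μ_i, ..., μ_j)` of `B` (i.e. with `μ_i - μ_j ≤ 1`), then for every
nilpotent `A` commuting with the Jordan matrix `J` of type `B` and every `m`,
`rank ((A^{s_B})^m) ≤ rank (J^m)`. -/
theorem rank_pow_sB_le
    (K : Type*) [Field K]
    (t : ℕ) (μ : Fin t → ℕ) (hpos : ∀ i, 0 < μ i)
    (hmono : ∀ i j : Fin t, i ≤ j → μ j ≤ μ i)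
    (s : ℕ)
    (hs : IsGreatest {d : ℕ | ∃ i j : Fin t, i ≤ j ∧ μ i ≤ μ j + 1 ∧
      d = (j : ℕ) - (i : ℕ) + 1} s) :
    ∀ A : Matrix (Σ i : Fin t, Fin (μ i)) (Σ i : Fin t, Fin (μ i)) K,
      A * jordanMatrix K t μ = jordanMatrix K t μ * A → IsNilpotent A →
      ∀ m : ℕ, ((A ^ s) ^ m).rank ≤ (jordanMatrix K t μ ^ m).rank := by
  intro A hA hnil m
  refine (rank_le_card_add_card _ (fun p => boxWeight p < -m) (fun q => (m : ℤ) ≤ boxWeight q)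
    fun p q h => ?_).trans ((card_boxWeight_lt_add_card_le_boxWeight m).trans
      (card_le_rank_jordanMatrix_pow m))
  have := boxWeight_add_le_of_pow_apply_ne_zero
    (fun p q => two_le_boxWeight_sub_of_pow_apply_ne_zero hs.2 hA hnil) m h
  omega
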